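/- arXiv:1711.01558 — 4 statements merged into one kernel-verified Lean document; each statement's English description precedes it below -/
import Mathlib

section
/- Let 𝒳 and 𝒵 be standard Borel spaces, P_X a probability measure on 𝒳, P_Z a probability measure on 𝒵, G : 𝒵 → 𝒳 measurable, and let P_G be the pushforward of P_Z under G. Let c : 𝒳 × 𝒳 → [0,∞] be measurable. Then the optimal transport cost W_c(P_X, P_G) equals the infimum, over all Markov kernels Q from 𝒳 to 𝒵 whose aggregated posterior Q_Z equals P_Z, of ∫∫ c(x, G(z)) dQ(x)(z) dP_X(x). -/
open MeasureTheory ProbabilityTheory ENNReal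

/-- The optimal transport cost between two measures on `𝒳` for cost `c`:
the infimum over all couplings (probability measures on `𝒳 × 𝒳` with the
prescribed marginals) of the integral of the cost. -/
noncomputable def transportCost {𝒳 : Type*} [MeasurableSpace 𝒳]
    (P Q : Measure 𝒳) (c : 𝒳 × 𝒳 → ℝ≥0∞) : ℝ≥0∞ :=
  ⨅ (Γ : Measure (𝒳 × 𝒳)) (_ : IsProbabilityMeasure Γ)
    (_ : Γ.fst = P) (_ : Γ.snd = Q), ∫⁻ p, c p ∂Γ

/-- A measure on the latent space disintegrates along a measurable map: some Markov kernel
transports the image measure back, and is concentrated on the fibres of the map. -/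
lemma exists_isMarkovKernel_fiber {𝒳 𝒵 : Type*} [MeasurableSpace 𝒳] [StandardBorelSpace 𝒳]
    [MeasurableSpace 𝒵] [StandardBorelSpace 𝒵] (μ : Measure 𝒵) [IsProbabilityMeasure μ]
    {G : 𝒵 → 𝒳} (hG : Measurable G) :
    ∃ K : Kernel 𝒳 𝒵, IsMarkovKernel K ∧ (μ.map G).bind K = μ ∧
      ∀ᵐ y ∂(μ.map G), ∀ᵐ z ∂(K y), G z = y := by
  have : Nonempty 𝒵 := nonempty_of_isProbabilityMeasure μ
  refine ⟨condDistrib id G μ, inferInstance, ?_, ?_⟩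
  · rw [condDistrib_comp_map hG.aemeasurable aemeasurable_id, Measure.map_id]
  · refine Measure.ae_ae_of_ae_compProd (p := fun q : 𝒳 × 𝒵 => G q.2 = q.1) ?_
    rw [compProd_map_condDistrib aemeasurable_id,
      ae_map_iff (hG.prodMk measurable_id).aemeasurable
        (measurableSet_eq_fun (by fun_prop) measurable_fst)]
    simp

/-- A Markov kernel transporting `μ` to `ν` yields a coupling of `μ` and `ν.map G`. -/
lemma transportCost_map_le {𝒳 𝒵 : Type*} [MeasurableSpace 𝒳] [MeasurableSpace 𝒵]
    (μ : Measure 𝒳) [IsProbabilityMeasure μ] {G : 𝒵 → 𝒳} (hG : Measurable G)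
    {c : 𝒳 × 𝒳 → ℝ≥0∞} (hc : Measurable c) (Q : Kernel 𝒳 𝒵) [IsMarkovKernel Q] :
    transportCost μ ((μ.bind Q).map G) c ≤ ∫⁻ x, ∫⁻ z, c (x, G z) ∂(Q x) ∂μ := by
  have hQG : IsMarkovKernel (Q.map G) := Kernel.IsMarkovKernel.map Q hG
  refine iInf_le_of_le (μ ⊗ₘ Q.map G) <| iInf₂_le_of_le inferInstance
    (Measure.fst_compProd _ _) <| iInf_le_of_le ?_ (le_of_eq ?_)
  · rw [Measure.snd_compProd, Measure.map_comp _ _ hG]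
  · rw [Measure.lintegral_compProd hc]
    refine lintegral_congr fun x => ?_
    rw [Kernel.map_apply _ hG, lintegral_map (by fun_prop) hG]

/-- A coupling of `μ` and `ν.map G` lifts to a Markov kernel transporting `μ` to `ν` with the
same cost. -/
lemma exists_isMarkovKernel_of_coupling {𝒳 𝒵 : Type*} [MeasurableSpace 𝒳]
    [StandardBorelSpace 𝒳] [MeasurableSpace 𝒵] [StandardBorelSpace 𝒵]
    (ν : Measure 𝒵) [IsProbabilityMeasure ν] {G : 𝒵 → 𝒳} (hG : Measurable G)
    {c : 𝒳 × 𝒳 → ℝ≥0∞} (hc : Measurable c) (Γ : Measure (𝒳 × 𝒳)) [IsProbabilityMeasure Γ]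
    (hΓ : Γ.snd = ν.map G) :
    ∃ Q : Kernel 𝒳 𝒵, IsMarkovKernel Q ∧ Γ.fst.bind Q = ν ∧
      ∫⁻ x, ∫⁻ z, c (x, G z) ∂(Q x) ∂Γ.fst = ∫⁻ p, c p ∂Γ := by
  have : Nonempty 𝒳 := (nonempty_of_isProbabilityMeasure ν).map G
  obtain ⟨K, hK, hKν, hKG⟩ := exists_isMarkovKernel_fiber ν hG
  have hΓ' : Γ.fst ⊗ₘ Γ.condKernel = Γ := Γ.disintegrate Γ.condKernel
  have hcG : Measurable fun q : 𝒳 × 𝒵 => c (q.1, G q.2) := by fun_prop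
  refine ⟨K ∘ₖ Γ.condKernel, inferInstance, ?_, ?_⟩
  · rw [← Measure.comp_assoc, ← Measure.snd_compProd Γ.fst, hΓ', hΓ, hKν]
  · have hae : ∀ᵐ p ∂Γ, ∀ᵐ z ∂(K p.2), G z = p.2 := by
      rw [← hΓ, Measure.snd] at hKG
      exact ae_of_ae_map measurable_snd.aemeasurable hKG
    have hmeas : Measurable fun p : 𝒳 × 𝒳 => ∫⁻ z, c (p.1, G z) ∂(K p.2) :=
      Measurable.lintegral_kernel_prod_right (κ := K.comap Prod.snd measurable_snd)
        (f := fun (p : 𝒳 × 𝒳) z => c (p.1, G z)) (by fun_prop)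
    calc ∫⁻ x, ∫⁻ z, c (x, G z) ∂((K ∘ₖ Γ.condKernel) x) ∂Γ.fst
        = ∫⁻ x, ∫⁻ y, ∫⁻ z, c (x, G z) ∂(K y) ∂(Γ.condKernel x) ∂Γ.fst :=
          lintegral_congr fun x =>
            Kernel.lintegral_comp _ _ _ (hcG.comp measurable_prodMk_left)
      _ = ∫⁻ p, ∫⁻ z, c (p.1, G z) ∂(K p.2) ∂Γ := by
          conv_rhs => rw [← hΓ', Measure.lintegral_compProd hmeas]
      _ = ∫⁻ p, c p ∂Γ := by
          refine lintegral_congr_ae (hae.mono fun p hp => ?_)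
          calc ∫⁻ z, c (p.1, G z) ∂(K p.2) = ∫⁻ _, c p ∂(K p.2) :=
                lintegral_congr_ae (hp.mono fun z hz => by simp only [hz])
            _ = c p := by simp

/-- Theorem 1 of the WAE paper: for a latent variable model with deterministic
decoder `G`, the optimal transport cost `W_c(P_X, G_* P_Z)` equals the infimum,
over Markov kernels `Q` from `𝒳` to `𝒵` whose aggregated posterior equals the
prior `P_Z`, of the expected reconstruction cost `∫∫ c(x, G(z)) dQ(x)(z) dP_X(x)`. -/
theorem wae_theorem_one
    {𝒳 𝒵 : Type*} [MeasurableSpace 𝒳] [StandardBorelSpace 𝒳]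
    [MeasurableSpace 𝒵] [StandardBorelSpace 𝒵]
    (P_X : Measure 𝒳) [IsProbabilityMeasure P_X]
    (P_Z : Measure 𝒵) [IsProbabilityMeasure P_Z]
    (G : 𝒵 → 𝒳) (hG : Measurable G)
    (c : 𝒳 × 𝒳 → ℝ≥0∞) (hc : Measurable c) :
    transportCost P_X (P_Z.map G) c
      = ⨅ (Q : Kernel 𝒳 𝒵) (_ : IsMarkovKernel Q)
          (_ : P_X.bind (fun x => Q x) = P_Z),
          ∫⁻ x, ∫⁻ z, c (x, G z) ∂(Q x) ∂P_X := by
  refine le_antisymm (le_iInf fun Q => le_iInf fun hQ => le_iInf fun hQZ => ?_)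
    (le_iInf fun Γ => le_iInf fun hΓ => le_iInf fun hfst => le_iInf fun hsnd => ?_)
  · rw [← hQZ]
    exact transportCost_map_le P_X hG hc Q
  · subst hfst
    obtain ⟨Q, hQ, hQZ, hcost⟩ := exists_isMarkovKernel_of_coupling P_Z hG hc Γ hsnd
    exact hcost ▸ iInf_le_of_le Q (iInf_le_of_le hQ (iInf_le_of_le hQZ le_rfl))
end

section
/- Let 𝒳 and 𝒵 be measurable spaces, P_X a probability measure on 𝒳, P_Z a probability measure on 𝒵, G : 𝒵 → 𝒳 measurable, and let P_G be the pushforward of P_Z under G. Let c : 𝒳 × 𝒳 → [0,∞] be measurable. For every Markov kernel Q from 𝒳 to 𝒵 whose aggregated posterior Q_Z equals P_Z, the optimal transport cost satisfies W_c(P_X, P_G) ≤ ∫∫ c(x, G(z)) dQ(x)(z) dP_X(x). -/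
open MeasureTheory ProbabilityTheory ENNReal

/-- Upper-bound direction of Theorem 1 of the WAE paper: any Markov kernel
(probabilistic encoder) `Q` from `𝒳` to `𝒵` whose aggregated posterior equals
the prior `P_Z` yields an upper bound on `W_c(P_X, G_* P_Z)`. -/
theorem wae_theorem_one_upper_bound
    {𝒳 𝒵 : Type*} [MeasurableSpace 𝒳] [MeasurableSpace 𝒵]
    (P_X : Measure 𝒳) [IsProbabilityMeasure P_X]
    (P_Z : Measure 𝒵) [IsProbabilityMeasure P_Z]
    (G : 𝒵 → 𝒳) (hG : Measurable G)
    (c : 𝒳 × 𝒳 → ℝ≥0∞) (hc : Measurable c)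
    (Q : Kernel 𝒳 𝒵) [IsMarkovKernel Q]
    (hQ : P_X.bind (fun x => Q x) = P_Z) :
    transportCost P_X (P_Z.map G) c ≤ ∫⁻ x, ∫⁻ z, c (x, G z) ∂(Q x) ∂P_X := by
  have hf : Measurable fun p : 𝒳 × 𝒵 => (p.1, G p.2) := by fun_prop
  have : IsProbabilityMeasure ((P_X ⊗ₘ Q).map fun p => (p.1, G p.2)) :=
    Measure.isProbabilityMeasure_map hf.aemeasurable
  have hfst : ((P_X ⊗ₘ Q).map fun p => (p.1, G p.2)).fst = P_X := by
    rw [Measure.fst_map_prodMk (by fun_prop)]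
    exact Measure.fst_compProd P_X Q
  have hsnd : ((P_X ⊗ₘ Q).map fun p => (p.1, G p.2)).snd = P_Z.map G := by
    rw [Measure.snd_map_prodMk measurable_fst, ← hQ]
    exact (Measure.map_map hG measurable_snd).symm.trans
      (congrArg (Measure.map G) (Measure.snd_compProd P_X Q))
  refine (iInf₂_le_of_le _ this (iInf₂_le hfst hsnd)).trans_eq ?_
  rw [lintegral_map hc hf]
  exact Measure.lintegral_compProd (hc.comp hf)
end

section
/- Let 𝒳 and 𝒵 be standard Borel spaces, P_X a probability measure on 𝒳, P_Z a probability measure on 𝒵, G : 𝒵 → 𝒳 measurable, and let P_G be the pushforward of P_Z under G. Let c : 𝒳 × 𝒳 → [0,∞] be measurable. Then the infimum, over all Markov kernels Q from 𝒳 to 𝒵 whose aggregated posterior Q_Z equals P_Z, of ∫∫ c(x, G(z)) dQ(x)(z) dP_X(x), is at most the optimal transport cost W_c(P_X, P_G); i.e., for every coupling Γ of P_X and P_G and every ε > 0 there exists a Markov kernel Q from 𝒳 to 𝒵 with aggregated posterior equal to P_Z such that ∫∫ c(x, G(z)) dQ(x)(z) dP_X(x) ≤ ∫ c dΓ + ε.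 -/
open MeasureTheory ProbabilityTheory ENNReal

/-- The nontrivial direction of Theorem 1 of the WAE paper: every transport plan
(coupling) `Γ` between `P_X` and `P_G = G_* P_Z` factors, up to any `ε > 0`,
through the latent space via a probabilistic encoder whose aggregated posterior
equals the prior `P_Z`. -/
theorem wae_theorem_one_lower_bound
    {𝒳 𝒵 : Type*} [MeasurableSpace 𝒳] [StandardBorelSpace 𝒳]
    [MeasurableSpace 𝒵] [StandardBorelSpace 𝒵]
    (P_X : Measure 𝒳) [IsProbabilityMeasure P_X]
    (P_Z : Measure 𝒵) [IsProbabilityMeasure P_Z]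
    (G : 𝒵 → 𝒳) (hG : Measurable G)
    (c : 𝒳 × 𝒳 → ℝ≥0∞) (hc : Measurable c)
    (Γ : Measure (𝒳 × 𝒳)) [IsProbabilityMeasure Γ]
    (hΓ₁ : Γ.fst = P_X) (hΓ₂ : Γ.snd = P_Z.map G)
    (ε : ℝ≥0∞) (hε : 0 < ε) :
    ∃ (Q : Kernel 𝒳 𝒵), IsMarkovKernel Q ∧ P_X.bind (fun x => Q x) = P_Z ∧
      ∫⁻ x, ∫⁻ z, c (x, G z) ∂(Q x) ∂P_X ≤ ∫⁻ p, c p ∂Γ + ε := by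
  have : Nonempty 𝒵 := nonempty_of_isProbabilityMeasure P_Z
  have : Nonempty 𝒳 := nonempty_of_isProbabilityMeasure P_X
  subst hΓ₁
  set R : Kernel 𝒳 𝒵 := (Kernel.deterministic G hG)†P_Z
  have hcond : Γ.condKernel ∘ₘ Γ.fst = Γ.snd := by
    rw [← Measure.snd_compProd, Γ.disintegrate]
  have hR_fiber : ∀ᵐ p ∂Γ, (R p.2).map G = Measure.dirac p.2 := by
    have h := deterministic_comp_posterior (μ := P_Z) hG
    rw [← hΓ₂] at h
    filter_upwards [ae_of_ae_map measurable_snd.aemeasurable h] with p hp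
    rwa [Kernel.deterministic_comp_eq_map, Kernel.map_apply _ hG, Kernel.id_apply] at hp
  refine ⟨R ∘ₖ Γ.condKernel, inferInstance, ?_, ?_⟩
  · change (R ∘ₖ Γ.condKernel) ∘ₘ Γ.fst = P_Z
    rw [← Measure.comp_assoc, hcond, hΓ₂, ← Measure.deterministic_comp_eq_map hG]
    exact posterior_comp_self
  · refine le_trans (le_of_eq ?_) le_self_add
    have hmeas : Measurable fun p : 𝒳 × 𝒳 ↦ ∫⁻ z, c (p.1, G z) ∂(R p.2) :=
      Measurable.lintegral_kernel_prod_right' (κ := R.comap Prod.snd measurable_snd)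
        (f := fun q : (𝒳 × 𝒳) × 𝒵 ↦ c (q.1.1, G q.2)) (by fun_prop)
    calc ∫⁻ x, ∫⁻ z, c (x, G z) ∂((R ∘ₖ Γ.condKernel) x) ∂Γ.fst
        = ∫⁻ x, ∫⁻ y, ∫⁻ z, c (x, G z) ∂(R y) ∂(Γ.condKernel x) ∂Γ.fst := by
          congr with x
          exact Kernel.lintegral_comp _ _ _ (by fun_prop)
      _ = ∫⁻ p, ∫⁻ z, c (p.1, G z) ∂(R p.2) ∂Γ := by
          conv_rhs => rw [← Γ.disintegrate Γ.condKernel]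
          exact (Measure.lintegral_compProd hmeas).symm
      _ = ∫⁻ p, c p ∂Γ := by
          refine lintegral_congr_ae ?_
          filter_upwards [hR_fiber] with p hp
          rw [← lintegral_map (f := fun y ↦ c (p.1, y)) (by fun_prop) hG, hp,
            lintegral_dirac' _ (by fun_prop)]
end

section
/- Let 𝒵 be a standard Borel space, d a positive natural number, P_X a probability measure on ℝ^d, P_Z a probability measure on 𝒵, and G : 𝒵 → ℝ^d measurable. Let ν be a Markov kernel from 𝒵 to ℝ^d such that for every z ∈ 𝒵, ν(z) has finite second moment, mean ∫ y dν(z)(y) = G(z), and coordinate variances ∫ (y_i − G(z)_i)² dν(z)(y) = σ_i² for fixed constants σ_1², ..., σ_d² ≥ 0. Let P_G be the probability measure on ℝ^d obtained by sampling Z ∼ P_Z and then Y ∼ ν(Z) (i.e., P_G = P_Z bound with ν). Then, with cost c(x, y) = ‖x − y‖₂², the optimal transport cost satisfies W_c(P_X, P_G) ≤ Σ_{i=1}^d σ_i² + inf over couplings μ of P_X and P_Z of ∫ ‖x − G(z)‖₂² dμ(x, z). -/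
open MeasureTheory ProbabilityTheory ENNReal

/-- Bias–variance decomposition of the mean squared distance to a fixed point. -/
lemma integral_norm_sub_sq_eq_add {E : Type*} [NormedAddCommGroup E] [InnerProductSpace ℝ E]
    [CompleteSpace E] [MeasurableSpace E] {m : Measure E} [IsProbabilityMeasure m]
    (hm : MemLp id 2 m) (x : E) :
    ∫ y, ‖x - y‖ ^ 2 ∂m = ∫ y, ‖y - ∫ w, w ∂m‖ ^ 2 ∂m + ‖x - ∫ w, w ∂m‖ ^ 2 := by
  set g : E := ∫ w, w ∂m with hg
  have hid : Integrable (fun y : E => y) m := hm.integrable one_le_two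
  have hsub : Integrable (fun y => y - g) m := hid.sub (integrable_const g)
  have hsq : Integrable (fun y => ‖y - g‖ ^ 2) m :=
    (hm.sub (memLp_const g)).integrable_norm_pow two_ne_zero
  have hinner : Integrable (fun y => 2 * inner ℝ (x - g) (y - g)) m :=
    (hsub.const_inner (x - g)).const_mul 2
  have hzero : ∫ y, 2 * inner ℝ (x - g) (y - g) ∂m = 0 := by
    rw [integral_const_mul, integral_inner hsub, integral_sub hid (integrable_const g), ← hg]
    simp
  have hdiff : Integrable (fun y => ‖x - g‖ ^ 2 - 2 * inner ℝ (x - g) (y - g)) m :=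
    (integrable_const _).sub hinner
  have hexp : ∀ y, ‖x - y‖ ^ 2
      = ‖y - g‖ ^ 2 + (‖x - g‖ ^ 2 - 2 * inner ℝ (x - g) (y - g)) := by
    intro y
    rw [← sub_sub_sub_cancel_right x y g, norm_sub_sq_real (x - g) (y - g)]
    ring
  rw [integral_congr_ae (ae_of_all _ hexp), integral_add hsq hdiff,
    integral_sub (integrable_const _) hinner, hzero]
  simp

/-- The mean squared distance from a point to a random vector of `ℝᵈ` is the total variance
plus the squared distance to the mean. -/
lemma lintegral_ofReal_norm_sub_sq {ι : Type*} [Fintype ι] {m : Measure (EuclideanSpace ℝ ι)}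
    [IsProbabilityMeasure m] (hmom : Integrable (fun y => ‖y‖ ^ 2) m)
    (x : EuclideanSpace ℝ ι) :
    ∫⁻ y, ENNReal.ofReal (‖x - y‖ ^ 2) ∂m
      = (∑ i, ENNReal.ofReal (∫ y, (y i - (∫ w, w ∂m) i) ^ 2 ∂m))
        + ENNReal.ofReal (‖x - ∫ w, w ∂m‖ ^ 2) := by
  have hm : MemLp id 2 m :=
    (memLp_two_iff_integrable_sq_norm aestronglyMeasurable_id).2 hmom
  have hcoord : ∀ i, Integrable (fun y : EuclideanSpace ℝ ι => (y i - (∫ w, w ∂m) i) ^ 2) m := by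
    intro i
    refine ((hm.sub (memLp_const (∫ w, w ∂m))).integrable_norm_pow two_ne_zero).mono'
      (by fun_prop) (ae_of_all _ fun y => ?_)
    rw [norm_pow]
    exact pow_le_pow_left₀ (norm_nonneg _) (PiLp.norm_apply_le (y - ∫ w, w ∂m) i) 2
  have hdist : Integrable (fun y => ‖x - y‖ ^ 2) m :=
    ((memLp_const x).sub hm).integrable_norm_pow two_ne_zero
  rw [← ofReal_integral_eq_lintegral_ofReal hdist (ae_of_all _ fun y => sq_nonneg _),
    integral_norm_sub_sq_eq_add hm x,
    ENNReal.ofReal_add (integral_nonneg fun y => sq_nonneg _) (sq_nonneg _),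
    ← ENNReal.ofReal_sum_of_nonneg fun i _ => integral_nonneg fun y => sq_nonneg _,
    ← integral_finsetSum _ fun i _ => hcoord i]
  simp_rw [EuclideanSpace.real_norm_sq_eq, PiLp.sub_apply]

/-- Corollary 1 of the WAE paper: for a latent variable model with random
decoder `ν` having mean function `G` and coordinate variances `σ_i²`, the
squared-Euclidean optimal transport cost `W_c(P_X, P_G)` is at most the total
variance `Σ_i σ_i²` plus the infimum over couplings of `P_X` and `P_Z` of the
expected squared reconstruction error `∫ ‖x − G(z)‖² dμ(x, z)`. -/
theorem wae_corollary_random_decoder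
    {𝒵 : Type*} [MeasurableSpace 𝒵] [StandardBorelSpace 𝒵]
    (d : ℕ) (hd : 0 < d)
    (P_X : Measure (EuclideanSpace ℝ (Fin d))) [IsProbabilityMeasure P_X]
    (P_Z : Measure 𝒵) [IsProbabilityMeasure P_Z]
    (G : 𝒵 → EuclideanSpace ℝ (Fin d)) (hG : Measurable G)
    (ν : Kernel 𝒵 (EuclideanSpace ℝ (Fin d))) [IsMarkovKernel ν]
    (σsq : Fin d → ℝ) (hσsq : ∀ i, 0 ≤ σsq i)
    (hmom : ∀ z, Integrable (fun y => ‖y‖ ^ 2) (ν z))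
    (hmean : ∀ z, ∫ y, y ∂(ν z) = G z)
    (hvar : ∀ z i, ∫ y, (y i - G z i) ^ 2 ∂(ν z) = σsq i)
    (P_G : Measure (EuclideanSpace ℝ (Fin d)))
    (hPG : P_G = P_Z.bind (fun z => ν z)) :
    transportCost P_X P_G (fun p => ENNReal.ofReal (‖p.1 - p.2‖ ^ 2))
      ≤ (∑ i, ENNReal.ofReal (σsq i))
        + ⨅ (μ : Measure (EuclideanSpace ℝ (Fin d) × 𝒵))
            (_ : IsProbabilityMeasure μ) (_ : μ.fst = P_X) (_ : μ.snd = P_Z),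
            ∫⁻ p, ENNReal.ofReal (‖p.1 - G p.2‖ ^ 2) ∂μ := by
  subst hPG
  simp only [ENNReal.add_iInf]
  refine le_iInf fun μ => le_iInf fun _ => le_iInf fun hfst => le_iInf fun hsnd => ?_
  let κ : Kernel (EuclideanSpace ℝ (Fin d) × 𝒵) (EuclideanSpace ℝ (Fin d)) :=
    ν.comap Prod.snd measurable_snd
  have hproj : Measurable (fun q : (EuclideanSpace ℝ (Fin d) × 𝒵) × EuclideanSpace ℝ (Fin d) =>
      (q.1.1, q.2)) := by fun_prop
  let Γ := (μ ⊗ₘ κ).map fun q => (q.1.1, q.2)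
  have hΓ : IsProbabilityMeasure Γ := Measure.isProbabilityMeasure_map hproj.aemeasurable
  have hΓfst : Γ.fst = P_X := by
    rw [← hfst, ← Measure.fst_compProd μ κ, Measure.fst, Measure.fst, Measure.fst,
      Measure.map_map measurable_fst hproj, Measure.map_map measurable_fst measurable_fst]
    rfl
  have hΓsnd : Γ.snd = P_Z.bind (fun z => ν z) := by
    have h : Γ.snd = (μ ⊗ₘ κ).snd := by
      rw [Measure.snd, Measure.snd, Measure.map_map measurable_snd hproj]
      rfl
    rw [h, Measure.snd_compProd, ← hsnd]
    ext s hs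
    rw [Measure.bind_apply hs κ.aemeasurable, Measure.bind_apply hs ν.aemeasurable,
      Measure.snd, lintegral_map (ν.measurable_coe hs) measurable_snd]
    rfl
  refine (iInf_le_of_le Γ <| iInf_le_of_le hΓ <| iInf_le_of_le hΓfst <|
    iInf_le_of_le hΓsnd le_rfl).trans_eq ?_
  rw [lintegral_map (by fun_prop) hproj, Measure.lintegral_compProd (by fun_prop)]
  have hcost : ∀ p : EuclideanSpace ℝ (Fin d) × 𝒵,
      ∫⁻ y, ENNReal.ofReal (‖p.1 - y‖ ^ 2) ∂(κ p)
        = (∑ i, ENNReal.ofReal (σsq i)) + ENNReal.ofReal (‖p.1 - G p.2‖ ^ 2) := by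
    intro p
    rw [Kernel.comap_apply, lintegral_ofReal_norm_sub_sq (hmom p.2), hmean p.2]
    simp_rw [hvar p.2]
  simp_rw [hcost]
  rw [lintegral_add_left measurable_const]
  simp
end
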